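/- arXiv:math/0611167 — 3 statements merged into one kernel-verified Lean document; each statement's English description precedes it below -/
import Mathlib

section
/- Let m be a positive integer, let R = ℤ[x_{ij} : 1 ≤ i < j ≤ 2m] be the polynomial ring over ℤ in the variables x_{ij}, and let A be the 2m×2m matrix over R whose (i,j) entry is x_{ij} if i < j, −x_{ij} if i > j, and 0 if i = j. Then det A = (f_{2m})². -/
/-- The index type for the variables `x_{ij}`, `1 ≤ i < j ≤ 2m`
(here realized as pairs of elements of `Fin (2*m)` in increasing order). -/
abbrev PairIdx (m : ℕ) := {p : Fin (2*m) × Fin (2*m) // p.1 < p.2}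

/-- The variable `x_{ij}` for `i < j`, extended symmetrically (`x_{ji} = x_{ij}`)
and by `0` on the diagonal. -/
noncomputable def xvar (R : Type*) [CommRing R] (m : ℕ) (i j : Fin (2*m)) :
    MvPolynomial (PairIdx m) R :=
  if h : i < j then MvPolynomial.X ⟨(i, j), h⟩
  else if h' : j < i then MvPolynomial.X ⟨(j, i), h'⟩
  else 0

open scoped Classical in
/-- The polynomial `f_{2m}` (the Pfaffian form): the sum, over all ways of
arranging `{1, …, 2m}` into a list of pairs `[[i₁,j₁], …, [i_m,j_m]]` with
`i_ν < j_ν` and `i₁ < i₂ < ⋯ < i_m` (encoded as permutations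
`σ` of `Fin (2m)` with `σ(2k) < σ(2k+1)` and `σ(0) < σ(2) < ⋯`), of
`sign(σ) · x_{i₁j₁} ⋯ x_{i_mj_m}`. -/
noncomputable def pfPoly (R : Type*) [CommRing R] (m : ℕ) :
    MvPolynomial (PairIdx m) R :=
  ∑ σ ∈ Finset.univ.filter (fun σ : Equiv.Perm (Fin (2*m)) =>
      (∀ k : Fin m,
        σ ⟨2*k.1, by have := k.2; omega⟩ < σ ⟨2*k.1+1, by have := k.2; omega⟩) ∧
      ∀ k l : Fin m, k < l →
        σ ⟨2*k.1, by have := k.2; omega⟩ < σ ⟨2*l.1, by have := l.2; omega⟩),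
    (Equiv.Perm.sign σ : ℤ) •
      ∏ k : Fin m,
        xvar R m (σ ⟨2*k.1, by have := k.2; omega⟩) (σ ⟨2*k.1+1, by have := k.2; omega⟩)

/-- The generic `2m × 2m` anti-symmetric matrix over `ℤ[x_{ij} : 1 ≤ i < j ≤ 2m]`:
its `(i,j)` entry is `x_{ij}` for `i < j`, `-x_{ji}` for `i > j`, and `0` for `i = j`. -/
noncomputable def AmatZ (m : ℕ) :
    Matrix (Fin (2*m)) (Fin (2*m)) (MvPolynomial (PairIdx m) ℤ) :=
  Matrix.of fun i j =>
    if h : i < j then MvPolynomial.X ⟨(i, j), h⟩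
    else if h' : j < i then - MvPolynomial.X ⟨(j, i), h'⟩
    else 0

open Equiv Matrix

/-- The signed product attached to a permutation in the expansion of the Pfaffian of a matrix whose
index set is split into `m` ordered pairs. -/
def pfTerm {R : Type*} [CommRing R] {m : ℕ} (A : Matrix (Fin m × Fin 2) (Fin m × Fin 2) R)
    (σ : Perm (Fin m × Fin 2)) : R :=
  (Perm.sign σ : ℤ) * ∏ k, A (σ (k, 0)) (σ (k, 1))

/-- The block diagonal matrix with `m` blocks `!![0, 1; -1, 0]`. -/
def pairJ (R : Type*) [CommRing R] (m : ℕ) : Matrix (Fin m × Fin 2) (Fin m × Fin 2) R :=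
  Matrix.kroneckerMap (· * ·) (1 : Matrix (Fin m) (Fin m) R) !![0, 1; -1, 0]

theorem det_pairJ (R : Type*) [CommRing R] (m : ℕ) : (pairJ R m).det = 1 := by
  rw [pairJ, det_kronecker]
  simp [det_fin_two]

/-- The permutation of `Fin m × Fin 2` which permutes the pairs by `s`, after permuting the entries
of the pair `k` by `e k`. -/
def pairPerm {m : ℕ} (s : Perm (Fin m)) (e : Fin m → Perm (Fin 2)) : Perm (Fin m × Fin 2) :=
  prodCongrLeft (fun _ => s) * prodCongrRight e

@[simp]
theorem pairPerm_apply {m : ℕ} (s : Perm (Fin m)) (e : Fin m → Perm (Fin 2)) (k : Fin m)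
    (b : Fin 2) : pairPerm s e (k, b) = (s k, e k b) := rfl

theorem sign_pairPerm {m : ℕ} (s : Perm (Fin m)) (e : Fin m → Perm (Fin 2)) :
    Perm.sign (pairPerm s e) = ∏ k, Perm.sign (e k) := by
  rw [pairPerm, Perm.sign_mul, Perm.sign_prodCongrLeft, Perm.sign_prodCongrRight]
  simp

theorem perm_fin_two_eq (e : Perm (Fin 2)) : e = 1 ∨ e = swap 0 1 := by
  revert e; decide

theorem pfTerm_mul_pairPerm {R : Type*} [CommRing R] {m : ℕ}
    {A : Matrix (Fin m × Fin 2) (Fin m × Fin 2) R} (hA : ∀ i j, A j i = -A i j)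
    (σ : Perm (Fin m × Fin 2)) (s : Perm (Fin m)) (e : Fin m → Perm (Fin 2)) :
    pfTerm A (σ * pairPerm s e) = pfTerm A σ := by
  have key (k : Fin m) : A (σ (s k, e k 0)) (σ (s k, e k 1)) =
      ((Perm.sign (e k) : ℤ) : R) * A (σ (s k, 0)) (σ (s k, 1)) := by
    rcases perm_fin_two_eq (e k) with h | h
    · simp [h]
    · simp [h, hA (σ (s k, 0)) (σ (s k, 1))]
  have hs : ∏ k, A (σ (s k, 0)) (σ (s k, 1)) = ∏ k, A (σ (k, 0)) (σ (k, 1)) :=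
    Equiv.prod_comp s fun k => A (σ (k, 0)) (σ (k, 1))
  have hsq : (∏ k, ((Perm.sign (e k) : ℤ) : R)) * ∏ k, ((Perm.sign (e k) : ℤ) : R) = 1 := by
    rw [← Finset.prod_mul_distrib]
    refine Finset.prod_eq_one fun k _ => ?_
    rcases Int.units_eq_one_or (Perm.sign (e k)) with h | h <;> simp [h]
  simp only [pfTerm, Perm.mul_apply, pairPerm_apply, key, Finset.prod_mul_distrib, hs,
    Perm.sign_mul, sign_pairPerm]
  push_cast
  linear_combination ((Perm.sign σ : ℤ) : R) * (∏ k, A (σ (k, 0)) (σ (k, 1))) * hsq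

/-- A permutation is pair-sorted with respect to `v` if each pair is increasing and the first
entries of the pairs are increasing. -/
def IsPairSorted {α : Type*} [LinearOrder α] {m : ℕ} (v : Fin m × Fin 2 → α)
    (σ : Perm (Fin m × Fin 2)) : Prop :=
  (∀ k, v (σ (k, 0)) < v (σ (k, 1))) ∧ StrictMono fun k => v (σ (k, 0))

theorem perm_eq_one_of_strictMono {m : ℕ} {s : Perm (Fin m)} (hs : StrictMono s) : s = 1 := by
  have : (s : Fin m → Fin m) = id :=
    (StrictMono.range_inj hs strictMono_id).1 (by simp [s.surjective.range_eq])
  ext k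
  simp [this]

theorem IsPairSorted.pairPerm_eq_one {α : Type*} [LinearOrder α] {m : ℕ} {v : Fin m × Fin 2 → α}
    {σ τ : Perm (Fin m × Fin 2)} (hσ : IsPairSorted v σ) (hτ : IsPairSorted v τ)
    {s : Perm (Fin m)} {e : Fin m → Perm (Fin 2)} (h : σ = τ * pairPerm s e) :
    s = 1 ∧ e = 1 := by
  subst h
  have he : e = 1 := by
    funext k
    refine (perm_fin_two_eq (e k)).resolve_right fun hk => ?_
    have := hσ.1 k
    simp only [Perm.mul_apply, pairPerm_apply, hk, swap_apply_left, swap_apply_right] at this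
    exact this.not_gt (hτ.1 _)
  refine ⟨perm_eq_one_of_strictMono fun i j hij => ?_, he⟩
  have := hσ.2 hij
  simp only [Perm.mul_apply, pairPerm_apply, he, Pi.one_apply, Perm.one_apply] at this
  exact hτ.2.lt_iff_lt.1 this

theorem exists_isPairSorted_mul_pairPerm {α : Type*} [LinearOrder α] {m : ℕ}
    {v : Fin m × Fin 2 → α} (hv : Function.Injective v) (τ : Perm (Fin m × Fin 2)) :
    ∃ (s : Perm (Fin m)) (e : Fin m → Perm (Fin 2)), IsPairSorted v (τ * pairPerm s e) := by
  have h (k : Fin m) : ∃ e : Perm (Fin 2), v (τ (k, e 0)) < v (τ (k, e 1)) := by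
    have hne : v (τ (k, 0)) ≠ v (τ (k, 1)) := by simp [hv.eq_iff]
    rcases hne.lt_or_gt with h | h
    · exact ⟨1, h⟩
    · exact ⟨swap 0 1, by simpa using h⟩
  choose e he using h
  let s := Tuple.sort fun k => v (τ (k, e k 0))
  have hs : Monotone fun k => v (τ (s k, e (s k) 0)) :=
    Tuple.monotone_sort fun k => v (τ (k, e k 0))
  refine ⟨s, fun k => e (s k), fun k => he (s k), hs.strictMono_of_injective fun i j hij => ?_⟩
  have := congrArg Prod.fst (τ.injective (hv hij))
  exact s.injective this

theorem pairPerm_mul {m : ℕ} (s t : Perm (Fin m)) (e f : Fin m → Perm (Fin 2)) :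
    pairPerm s e * pairPerm t f = pairPerm (s * t) fun k => e (t k) * f k := by
  ext1 ⟨k, b⟩
  rfl

theorem pairPerm_one {m : ℕ} : pairPerm (1 : Perm (Fin m)) 1 = 1 := rfl

theorem pairPerm_inv {m : ℕ} (s : Perm (Fin m)) (e : Fin m → Perm (Fin 2)) :
    (pairPerm s e)⁻¹ = pairPerm s⁻¹ fun k => (e (s⁻¹ k))⁻¹ := by
  rw [inv_eq_iff_mul_eq_one, pairPerm_mul, ← pairPerm_one]
  congr 1
  · simp
  · funext k; simp

theorem bijective_isPairSorted_mul_pairPerm {α : Type*} [LinearOrder α] {m : ℕ}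
    {v : Fin m × Fin 2 → α} (hv : Function.Injective v) :
    Function.Bijective fun p : (Perm (Fin m) × (Fin m → Perm (Fin 2))) ×
      {σ : Perm (Fin m × Fin 2) // IsPairSorted v σ} => p.2.1 * pairPerm p.1.1 p.1.2 := by
  constructor
  · rintro ⟨⟨s, e⟩, σ, hσ⟩ ⟨⟨t, f⟩, τ, hτ⟩ h
    dsimp only at h
    have h' : σ = τ * pairPerm (t * s⁻¹) fun k => f (s⁻¹ k) * (e (s⁻¹ k))⁻¹ := by
      rw [← pairPerm_mul, ← pairPerm_inv, ← mul_assoc, ← h, mul_inv_cancel_right]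
    obtain ⟨h₁, h₂⟩ := hσ.pairPerm_eq_one hτ h'
    have hts : t = s := mul_inv_eq_one.1 h₁
    have hfe : f = e := by
      funext k
      have := congrFun h₂ (s k)
      simpa [mul_inv_eq_one] using this
    subst hts hfe
    rw [mul_left_inj] at h
    subst h
    rfl
  · intro τ
    obtain ⟨s, e, h⟩ := exists_isPairSorted_mul_pairPerm hv τ
    refine ⟨⟨⟨s⁻¹, fun k => (e (s⁻¹ k))⁻¹⟩, _, h⟩, ?_⟩
    dsimp only
    rw [← pairPerm_inv, mul_inv_cancel_right]

open scoped Classical in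
theorem sum_pfTerm_eq_card_mul {R : Type*} [CommRing R] {α : Type*} [LinearOrder α] {m : ℕ}
    {v : Fin m × Fin 2 → α} (hv : Function.Injective v)
    {A : Matrix (Fin m × Fin 2) (Fin m × Fin 2) R} (hA : ∀ i j, A j i = -A i j) :
    ∑ σ, pfTerm A σ = Fintype.card (Perm (Fin m) × (Fin m → Perm (Fin 2))) *
      ∑ σ with IsPairSorted v σ, pfTerm A σ := by
  rw [← Fintype.sum_bijective _ (bijective_isPairSorted_mul_pairPerm hv)
    (fun p => pfTerm A p.2.1) _ fun p => (pfTerm_mul_pairPerm hA _ _ _).symm,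
    Fintype.sum_prod_type]
  simp only [Finset.sum_const, Finset.card_univ, nsmul_eq_mul]
  congr 1
  exact (Finset.sum_subtype _ (by simp) _).symm

theorem sum_pfTerm_mul_mul_transpose {R : Type*} [CommRing R] {m : ℕ}
    (B A : Matrix (Fin m × Fin 2) (Fin m × Fin 2) R) :
    ∑ σ, pfTerm (B * A * Bᵀ) σ = B.det * ∑ σ, pfTerm A σ := by
  have hdet (p : Fin m × Fin 2 → Fin m × Fin 2) :
      (B.submatrix id p).det = ∑ σ : Perm (Fin m × Fin 2), ((Perm.sign σ : ℤ) : R) *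
        ∏ k, B (σ (k, 0)) (p (k, 0)) * B (σ (k, 1)) (p (k, 1)) := by
    simp [det_apply', Fintype.prod_prod_type]
  let φ : (Fin m × Fin 2 → Fin m × Fin 2) ≃ (Fin m → (Fin m × Fin 2) × (Fin m × Fin 2)) :=
    (Equiv.curry _ _ _).trans (Equiv.arrowCongr (Equiv.refl _) (finTwoArrowEquiv _))
  have hentry (i j : Fin m × Fin 2) : (B * A * Bᵀ) i j =
      ∑ q : (Fin m × Fin 2) × (Fin m × Fin 2), B i q.1 * B j q.2 * A q.1 q.2 := by
    rw [Fintype.sum_prod_type_right]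
    simp only [mul_apply, transpose_apply, Finset.sum_mul]
    exact Finset.sum_congr rfl fun y _ => Finset.sum_congr rfl fun x _ => by ring
  calc ∑ σ, pfTerm (B * A * Bᵀ) σ
      = ∑ p : Fin m × Fin 2 → Fin m × Fin 2,
          (B.submatrix id p).det * ∏ k, A (p (k, 0)) (p (k, 1)) := by
        simp only [pfTerm, hentry, Fintype.prod_sum, Finset.mul_sum]
        rw [Finset.sum_comm, ← Equiv.sum_comp φ]
        refine Finset.sum_congr rfl fun p _ => ?_
        rw [hdet, Finset.sum_mul]
        refine Finset.sum_congr rfl fun σ _ => ?_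
        rw [Finset.prod_mul_distrib, ← mul_assoc]
        rfl
    _ = ∑ p : Fin m × Fin 2 → Fin m × Fin 2 with Function.Bijective p,
          (B.submatrix id p).det * ∏ k, A (p (k, 0)) (p (k, 1)) := by
        refine (Finset.sum_subset (Finset.filter_subset _ _) fun p _ hp => ?_).symm
        rw [Finset.mem_filter_univ, ← Finite.injective_iff_bijective, Function.Injective] at hp
        push Not at hp
        obtain ⟨i, j, hpij, hij⟩ := hp
        rw [det_zero_of_column_eq hij (by simp [hpij]), zero_mul]
    _ = ∑ τ : Perm (Fin m × Fin 2),
          (B.submatrix id τ).det * ∏ k, A (τ (k, 0)) (τ (k, 1)) :=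
        Finset.sum_bij (fun p h => Equiv.ofBijective p (Finset.mem_filter.1 h).2)
          (fun _ _ => Finset.mem_univ _) (fun _ _ _ _ h => by injection h)
          (fun b _ => ⟨b, Finset.mem_filter.2 ⟨Finset.mem_univ _, b.bijective⟩,
            DFunLike.coe_injective rfl⟩) fun _ _ => rfl
    _ = B.det * ∑ σ, pfTerm A σ := by
        rw [Finset.mul_sum]
        refine Finset.sum_congr rfl fun τ _ => ?_
        rw [det_permute', pfTerm]
        ring

/-- An alternating form supported on at most `2 * m` indices is a sum of `m` decomposable ones. -/
theorem exists_sum_of_alternating {K ι : Type*} [Field K] [DecidableEq ι] (m : ℕ) (S : Finset ι)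
    (hS : S.card ≤ 2 * m) (A : Matrix ι ι K) (hA : ∀ i j, A j i = -A i j) (hA₀ : ∀ i, A i i = 0)
    (hsupp : ∀ i j, i ∉ S → A i j = 0) :
    ∃ U V : ι → Fin m → K, ∀ i j, A i j = ∑ k, (U i k * V j k - V i k * U j k) := by
  induction m generalizing S A with
  | zero =>
    have : S = ∅ := by simpa using hS
    exact ⟨0, 0, fun i j => by simp [hsupp i j, this]⟩
  | succ m ih =>
    by_cases hz : ∀ i j, A i j = 0
    · exact ⟨0, 0, fun i j => by simp [hz]⟩
    push Not at hz
    obtain ⟨i, j, hij⟩ := hz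
    have hiS : i ∈ S := by
      by_contra h
      exact hij (hsupp i j h)
    have hjS : j ∈ S := by
      by_contra h
      exact hij (by rw [hA j i, hsupp j i h, neg_zero])
    have hne : j ≠ i := by
      rintro rfl
      exact hij (hA₀ j)
    let A' : Matrix ι ι K := fun x y => A x y - (A x j / A i j * A i y - A i x * (A y j / A i j))
    obtain ⟨U, V, h⟩ := ih ((S.erase i).erase j)
      (by
        rw [Finset.card_erase_of_mem (Finset.mem_erase.2 ⟨hne, hjS⟩), Finset.card_erase_of_mem hiS]
        omega) A'
      (fun x y => by
        simp only [A']
        rw [hA x y]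
        ring)
      (fun x => by
        simp only [A', hA₀]
        ring)
      (fun x y hx => by
        simp only [A']
        by_cases hxj : x = j
        · subst hxj
          rw [hA₀, hA y x]
          field_simp
          ring
        by_cases hxi : x = i
        · subst hxi
          rw [hA₀]
          field_simp
          ring
        have hxS : x ∉ S := fun h => hx (by simp [h, hxi, hxj])
        rw [hA x i, hsupp x y hxS, hsupp x j hxS, hsupp x i hxS]
        ring)
    refine ⟨fun x => Fin.cons (A x j / A i j) (U x), fun x => Fin.cons (A i x) (V x),
      fun x y => ?_⟩
    simp only [Fin.sum_univ_succ, Fin.cons_zero, Fin.cons_succ, ← h, A']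
    ring

theorem exists_eq_mul_pairJ_mul_transpose {K : Type*} [Field K] {m : ℕ}
    (A : Matrix (Fin m × Fin 2) (Fin m × Fin 2) K) (hA : ∀ i j, A j i = -A i j)
    (hA₀ : ∀ i, A i i = 0) : ∃ B, A = B * pairJ K m * Bᵀ := by
  obtain ⟨U, V, h⟩ := exists_sum_of_alternating m Finset.univ (by simp [mul_comm]) A hA hA₀
    (by simp)
  refine ⟨Matrix.of fun x p => if p.2 = 0 then U x p.1 else V x p.1, ?_⟩
  ext i j
  rw [h]
  simp [mul_apply, pairJ, Fintype.sum_prod_type, one_apply, Finset.sum_add_distrib]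
  ring

open scoped Classical in
/-- The Pfaffian of the standard symplectic matrix is `1`. -/
theorem sum_isPairSorted_pfTerm_pairJ (R : Type*) [CommRing R] {α : Type*} [LinearOrder α] {m : ℕ}
    {v : Fin m × Fin 2 → α} (hv : IsPairSorted v 1) :
    ∑ σ with IsPairSorted v σ, pfTerm (pairJ R m) σ = 1 := by
  rw [Finset.sum_eq_single_of_mem 1 (by simpa using hv)]
  · simp [pfTerm, pairJ]
  · intro σ hσ hne
    rw [Finset.mem_filter_univ] at hσ
    by_contra hz
    refine hne ?_
    have h (k : Fin m) : σ (k, 0) = ((σ (k, 0)).1, 0) ∧ σ (k, 1) = ((σ (k, 0)).1, 1) := by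
      have hk : pairJ R m (σ (k, 0)) (σ (k, 1)) ≠ 0 := fun h0 =>
        hz (by rw [pfTerm, Finset.prod_eq_zero (Finset.mem_univ k) h0, mul_zero])
      have hlt := hσ.1 k
      generalize σ (k, 0) = p at hk hlt ⊢
      generalize σ (k, 1) = q at hk hlt ⊢
      obtain ⟨a, b⟩ := p
      obtain ⟨c, d⟩ := q
      have hac : a = c := by
        by_contra hac
        exact hk (by simp [pairJ, hac])
      subst hac
      have := hv.1 a
      fin_cases b <;> fin_cases d <;> simp_all [pairJ]
      exact this.not_gt hlt
    have hinj : Function.Injective fun k => (σ (k, 0)).1 := fun k l hkl => by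
      have : σ (k, 0) = σ (l, 0) := by
        rw [(h k).1, (h l).1]
        simpa using hkl
      simpa using this
    let s : Perm (Fin m) := Equiv.ofBijective _ (Finite.injective_iff_bijective.1 hinj)
    have hσs : σ = 1 * pairPerm s 1 := by
      ext1 ⟨k, b⟩
      fin_cases b
      · exact (h k).1
      · exact (h k).2
    rw [hσs, (hσ.pairPerm_eq_one hv hσs).1, one_mul, pairPerm_one]

open scoped Classical in
theorem det_eq_sq_sum_isPairSorted_pfTerm {K : Type*} [Field K] [CharZero K] {α : Type*}
    [LinearOrder α] {m : ℕ} {v : Fin m × Fin 2 → α} (hv : Function.Injective v)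
    (hv₁ : IsPairSorted v 1) (A : Matrix (Fin m × Fin 2) (Fin m × Fin 2) K)
    (hA : ∀ i j, A j i = -A i j) (hA₀ : ∀ i, A i i = 0) :
    A.det = (∑ σ with IsPairSorted v σ, pfTerm A σ) ^ 2 := by
  obtain ⟨B, hB⟩ := exists_eq_mul_pairJ_mul_transpose A hA hA₀
  have hJ (i j) : pairJ K m j i = -pairJ K m i j := by
    obtain ⟨a, b⟩ := i
    obtain ⟨c, d⟩ := j
    by_cases hac : a = c
    · subst hac
      fin_cases b <;> fin_cases d <;> simp [pairJ]
    · simp [pairJ, hac, Ne.symm hac]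
  have hP := sum_pfTerm_mul_mul_transpose B (pairJ K m)
  rw [← hB, sum_pfTerm_eq_card_mul hv hA, sum_pfTerm_eq_card_mul hv hJ,
    sum_isPairSorted_pfTerm_pairJ K hv₁, mul_one, mul_comm B.det] at hP
  rw [mul_left_cancel₀ (Nat.cast_ne_zero.2 Fintype.card_ne_zero) hP, hB, det_mul, det_mul,
    det_transpose, det_pairJ]
  ring

/-- The enumeration of `Fin (2 * m)` by consecutive pairs. -/
def pairEquiv (m : ℕ) : Fin m × Fin 2 ≃ Fin (2 * m) :=
  finProdFinEquiv.trans (finCongr (mul_comm m 2))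

theorem pairEquiv_zero {m : ℕ} (k : Fin m) :
    pairEquiv m (k, 0) = ⟨2 * k.1, by have := k.2; omega⟩ := by
  ext; simp [pairEquiv]

theorem pairEquiv_one {m : ℕ} (k : Fin m) :
    pairEquiv m (k, 1) = ⟨2 * k.1 + 1, by have := k.2; omega⟩ := by
  ext; simp [pairEquiv]; ring

theorem isPairSorted_pairEquiv_one (m : ℕ) : IsPairSorted (pairEquiv m) 1 := by
  refine ⟨fun k => ?_, fun k l hkl => ?_⟩
  · simp [pairEquiv_zero, pairEquiv_one]
  · simpa [pairEquiv_zero] using hkl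

theorem AmatZ_apply_of_lt {m : ℕ} {i j : Fin (2 * m)} (h : i < j) :
    AmatZ m i j = xvar ℤ m i j := by
  simp [AmatZ, xvar, h]

theorem AmatZ_apply_swap {m : ℕ} (i j : Fin (2 * m)) : AmatZ m j i = -AmatZ m i j := by
  rcases lt_trichotomy i j with h | rfl | h
  · simp [AmatZ, h, h.not_gt]
  · simp [AmatZ]
  · simp [AmatZ, h, h.not_gt]

theorem AmatZ_apply_self {m : ℕ} (i : Fin (2 * m)) : AmatZ m i i = 0 := by
  simp [AmatZ]

open scoped Classical in
theorem pfPoly_eq_sum_pfTerm (m : ℕ) : pfPoly ℤ m =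
    ∑ σ with IsPairSorted (pairEquiv m) σ,
      pfTerm ((AmatZ m).submatrix (pairEquiv m) (pairEquiv m)) σ := by
  symm
  refine Finset.sum_equiv (pairEquiv m).permCongr (fun σ => ?_) fun σ hσ => ?_
  · rw [Finset.mem_filter_univ, Finset.mem_filter_univ]
    simp only [← pairEquiv_zero, ← pairEquiv_one, permCongr_apply, symm_apply_apply]
    exact Iff.rfl
  · rw [Finset.mem_filter_univ] at hσ
    simp only [pfTerm, ← pairEquiv_zero, ← pairEquiv_one, permCongr_apply, symm_apply_apply,
      submatrix_apply, zsmul_eq_mul, Perm.sign_permCongr]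
    congr 1
    exact Finset.prod_congr rfl fun k _ => AmatZ_apply_of_lt (hσ.1 k)

theorem map_pfTerm {R S : Type*} [CommRing R] [CommRing S] (f : R →+* S) {m : ℕ}
    (A : Matrix (Fin m × Fin 2) (Fin m × Fin 2) R) (σ : Perm (Fin m × Fin 2)) :
    f (pfTerm A σ) = pfTerm (f.mapMatrix A) σ := by
  simp [pfTerm]

/-- The determinant of the generic anti-symmetric `2m × 2m` matrix is the square
of the polynomial `f_{2m}`. -/
theorem det_generic_antisymmetric_eq_pf_sq (m : ℕ) (hm : 0 < m) :
    (AmatZ m).det = (pfPoly ℤ m) ^ 2 := by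
  classical
  let K := FractionRing (MvPolynomial (PairIdx m) ℤ)
  let f : MvPolynomial (PairIdx m) ℤ →+* K := algebraMap _ _
  have hf : Function.Injective f := IsFractionRing.injective _ _
  have : CharZero K := ⟨fun a b h => by
    have h' : f a = f b := by simpa using h
    exact_mod_cast hf h'⟩
  refine hf ?_
  rw [← det_submatrix_equiv_self (pairEquiv m), pfPoly_eq_sum_pfTerm, RingHom.map_det, map_pow,
    map_sum]
  simp only [map_pfTerm]
  refine det_eq_sq_sum_isPairSorted_pfTerm (pairEquiv m).injective (isPairSorted_pairEquiv_one m) _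
    (fun i j => ?_) fun i => ?_
  · simp [AmatZ_apply_swap (pairEquiv m i) (pairEquiv m j)]
  · simp [AmatZ_apply_self]
end

section
/- Let k be a field of characteristic 2, let m ≥ 2, let S = k[x_{ij} : 1 ≤ i < j ≤ 2m] be the polynomial ring, and let A be the 2m×2m matrix over S whose (i,j) entry is x_{ij} if i < j, x_{ij} if i > j, and 0 if i = j. Let g ∈ S be the unique polynomial with g² = det(J_{2m−2,2m} + A), and write z := x_{2m−1,2m}. Then the homogeneous component of g of degree 0 is 0, the homogeneous component of degree 1 is z, and the homogeneous component of degree 2 is Σ_{j=1}^{m−1} x_{2j−1,2j}·z + Σ_{i=1}^{2m−2} x_{i,2m−1}·x_{τ(i),2m}. -/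
/-- Constructor for the variable index `x_{ij}` from natural numbers `i < j < 2m`. -/
def pidx (m i j : ℕ) (h1 : i < j) (h2 : j < 2*m) : PairIdx m :=
  ⟨(⟨i, h1.trans h2⟩, ⟨j, h2⟩), Fin.mk_lt_mk.mpr h1⟩

/-- `τ(i) = i + 1` if `i` is even, `i - 1` if `i` is odd (0-indexed version of the
pairing involution `τ`). -/
def tau0 (i : ℕ) : ℕ := if i % 2 = 0 then i + 1 else i - 1

/-- `Jmat K r n` is the `n × n` matrix `J_{2r,n}` having `r` copies of the
`2 × 2` block `J₂ = [[0,1],[-1,0]]` placed consecutively along the diagonal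
starting from the top-left corner, and all other entries `0`. -/
def Jmat (K : Type*) [CommRing K] (r n : ℕ) : Matrix (Fin n) (Fin n) K :=
  Matrix.of fun i j =>
    if (j : ℕ) = (i : ℕ) + 1 ∧ (i : ℕ) % 2 = 0 ∧ (j : ℕ) < 2 * r then (1 : K)
    else if (i : ℕ) = (j : ℕ) + 1 ∧ (j : ℕ) % 2 = 0 ∧ (i : ℕ) < 2 * r then -1
    else 0

/-- The generic `2m × 2m` anti-symmetric matrix in characteristic `2`: the `(i,j)`
entry is `x_{ij}` for `i < j`, `x_{ji}` for `i > j`, and `0` for `i = j`. -/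
noncomputable def AmatSym (k : Type*) [Field k] (m : ℕ) :
    Matrix (Fin (2*m)) (Fin (2*m)) (MvPolynomial (PairIdx m) k) :=
  Matrix.of fun i j =>
    if h : i < j then MvPolynomial.X ⟨(i, j), h⟩
    else if h' : j < i then MvPolynomial.X ⟨(j, i), h'⟩
    else 0

section HomogeneousComponents

open MvPolynomial

variable {V R : Type*} [CommRing R]

lemma homogeneousComponent_mul_add_of_isHomogeneous {n : ℕ} {p : MvPolynomial V R}
    (hp : p.IsHomogeneous n) (d : ℕ) (q : MvPolynomial V R) :
    homogeneousComponent (n + d) (p * q) = p * homogeneousComponent d q := by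
  let _ := MvPolynomial.gradedAlgebra (σ := V) (R := R)
  have h := DirectSum.coe_decompose_mul_add_of_left_mem (homogeneousSubmodule V R) (i := n) (j := d)
    (b := q) hp
  simp only [← decomposition.decompose'_apply]
  exact h

lemma homogeneousComponent_mul_of_isHomogeneous_of_lt {n d : ℕ} {p : MvPolynomial V R}
    (hp : p.IsHomogeneous n) (hd : d < n) (q : MvPolynomial V R) :
    homogeneousComponent d (p * q) = 0 := by
  let _ := MvPolynomial.gradedAlgebra (σ := V) (R := R)
  have h := DirectSum.coe_decompose_mul_of_left_mem_of_not_le (homogeneousSubmodule V R) (i := n)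
    (n := d) (b := q) hp (by omega)
  simp only [← decomposition.decompose'_apply]
  exact h

variable {α : Type*} {f : α → MvPolynomial V R}

lemma homogeneousComponent_zero_prod_one_add (hf : ∀ a, (f a).IsHomogeneous 1) (s : Finset α) :
    homogeneousComponent 0 (∏ a ∈ s, (1 + f a)) = 1 := by
  classical
  induction s using Finset.induction_on with
  | empty => simp
  | insert a s ha ih =>
    rw [Finset.prod_insert ha, add_mul, one_mul, map_add, ih,
      homogeneousComponent_mul_of_isHomogeneous_of_lt (hf a) one_pos, add_zero]

lemma homogeneousComponent_one_prod_one_add (hf : ∀ a, (f a).IsHomogeneous 1) (s : Finset α) :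
    homogeneousComponent 1 (∏ a ∈ s, (1 + f a)) = ∑ a ∈ s, f a := by
  classical
  induction s using Finset.induction_on with
  | empty =>
    simpa using homogeneousComponent_of_mem (m := 1) (isHomogeneous_one V R)
  | insert a s ha ih =>
    have h := homogeneousComponent_mul_add_of_isHomogeneous (hf a) 0 (∏ a ∈ s, (1 + f a))
    rw [homogeneousComponent_zero_prod_one_add hf, add_zero, mul_one] at h
    rw [Finset.prod_insert ha, add_mul, one_mul, map_add, ih, h, Finset.sum_insert ha, add_comm]

variable {N : α → Prop} [DecidablePred N]

lemma prod_ite_add (f : α → MvPolynomial V R) (s : Finset α) :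
    ∏ a ∈ s, ((if N a then 0 else 1) + f a) =
      (∏ a ∈ s with N a, f a) * ∏ a ∈ s with ¬ N a, (1 + f a) := by
  rw [← Finset.prod_filter_mul_prod_filter_not s N]
  congr 1 <;> refine Finset.prod_congr rfl fun a ha => ?_ <;>
    simp [(Finset.mem_filter.mp ha).2]

lemma isHomogeneous_prod_card (hf : ∀ a, (f a).IsHomogeneous 1) (s : Finset α) :
    (∏ a ∈ s, f a).IsHomogeneous s.card := by
  simpa using IsHomogeneous.prod s f (fun _ => 1) fun a _ => hf a

lemma homogeneousComponent_prod_ite_add_of_lt (hf : ∀ a, (f a).IsHomogeneous 1) (s : Finset α)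
    {d : ℕ} (hd : d < (s.filter N).card) :
    homogeneousComponent d (∏ a ∈ s, ((if N a then 0 else 1) + f a)) = 0 := by
  rw [prod_ite_add]
  exact homogeneousComponent_mul_of_isHomogeneous_of_lt (isHomogeneous_prod_card hf _) hd _

lemma homogeneousComponent_card_prod_ite_add (hf : ∀ a, (f a).IsHomogeneous 1) (s : Finset α) :
    homogeneousComponent (s.filter N).card (∏ a ∈ s, ((if N a then 0 else 1) + f a)) =
      ∏ a ∈ s with N a, f a := by
  rw [prod_ite_add]
  have h := homogeneousComponent_mul_add_of_isHomogeneous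
    (isHomogeneous_prod_card hf (s.filter N)) 0 (∏ a ∈ s with ¬ N a, (1 + f a))
  rwa [homogeneousComponent_zero_prod_one_add hf, mul_one] at h

lemma homogeneousComponent_card_add_one_prod_ite_add (hf : ∀ a, (f a).IsHomogeneous 1)
    (s : Finset α) :
    homogeneousComponent ((s.filter N).card + 1) (∏ a ∈ s, ((if N a then 0 else 1) + f a)) =
      (∏ a ∈ s with N a, f a) * ∑ a ∈ s with ¬ N a, f a := by
  rw [prod_ite_add, homogeneousComponent_mul_add_of_isHomogeneous
    (isHomogeneous_prod_card hf (s.filter N)), homogeneousComponent_one_prod_one_add hf]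

end HomogeneousComponents

section Matchings

open Equiv

variable {ι : Type*} [Fintype ι] [LinearOrder ι]

/-- The fixed-point-free involutions of `ι`, i.e. the perfect matchings on `ι`. -/
def matchings (ι : Type*) [Fintype ι] [LinearOrder ι] : Finset (Perm ι) :=
  Finset.univ.filter fun σ => ∀ i, σ (σ i) = i ∧ σ i ≠ i

lemma mem_matchings {σ : Perm ι} : σ ∈ matchings ι ↔ ∀ i, σ (σ i) = i ∧ σ i ≠ i := by
  simp [matchings]

/-- In characteristic two, the determinant of a symmetric matrix with zero diagonal is the square
of its Pfaffian. -/
lemma det_eq_sum_matchings_sq {R : Type*} [CommRing R] [CharP R 2] (M : Matrix ι ι R)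
    (hsymm : ∀ i j, M i j = M j i) (hdiag : ∀ i, M i i = 0) :
    M.det = (∑ σ ∈ matchings ι, ∏ i with i < σ i, M i (σ i)) ^ 2 := by
  have hsign : ∀ σ : Perm ι, ((Perm.sign σ : ℤ) : R) = 1 := fun σ => by
    rcases Int.units_eq_one_or (Perm.sign σ) with h | h <;> simp [h, CharTwo.neg_eq]
  have hinv : ∀ σ : Perm ι, ∏ i, M (σ⁻¹ i) i = ∏ i, M (σ i) i := fun σ => by
    rw [← Equiv.prod_comp σ]
    exact Finset.prod_congr rfl fun i _ => by
      rw [show σ⁻¹ (σ i) = i by simp, hsymm]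
  rw [Matrix.det_apply', CharTwo.sum_sq]
  simp only [hsign, one_mul]
  rw [← Finset.sum_filter_add_sum_filter_not Finset.univ (fun σ : Perm ι => σ⁻¹ = σ)]
  have hzero : ∑ σ : Perm ι with ¬ σ⁻¹ = σ, ∏ i, M (σ i) i = 0 := by
    refine Finset.sum_involution (fun σ _ => σ⁻¹) ?_ ?_ ?_ ?_
    · intro σ _
      rw [hinv, CharTwo.add_self_eq_zero]
    · intro σ hσ _
      exact (Finset.mem_filter.mp hσ).2
    · intro σ hσ
      simpa [eq_comm] using hσ
    · intro σ _
      exact inv_inv σ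
  rw [hzero, add_zero]
  symm
  refine Finset.sum_subset_zero_on_sdiff ?_ ?_ ?_
  · intro σ hσ
    rw [mem_matchings] at hσ
    rw [Finset.mem_filter]
    refine ⟨Finset.mem_univ _, inv_eq_of_mul_eq_one_left ?_⟩
    ext i
    exact (hσ i).1
  · intro σ hσ
    rw [Finset.mem_sdiff, Finset.mem_filter, mem_matchings] at hσ
    obtain ⟨⟨_, h⟩, hfix⟩ := hσ
    have hσσ : ∀ i, σ (σ i) = i := fun i => by
      nth_rewrite 1 [← h]
      simp
    obtain ⟨i, hi⟩ : ∃ i, σ i = i := by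
      by_contra! hne
      exact hfix fun i => ⟨hσσ i, hne i⟩
    exact Finset.prod_eq_zero (Finset.mem_univ i) (by rw [hi, hdiag])
  · intro σ hσ
    rw [mem_matchings] at hσ
    rw [sq, ← Finset.prod_filter_mul_prod_filter_not Finset.univ (fun i => i < σ i)]
    congr 1
    · exact Finset.prod_congr rfl fun i _ => hsymm _ _
    · refine Finset.prod_nbij' σ σ ?_ ?_ ?_ ?_ ?_
      · intro i hi
        simpa [(hσ i).1] using (Finset.mem_filter.mp hi).2.le
      · intro i hi
        have := (Finset.mem_filter.mp hi).2
        simpa [(hσ i).1] using lt_of_le_of_ne (not_lt.mp this) (hσ i).2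
      · exact fun i _ => (hσ i).1
      · exact fun i _ => (hσ i).1
      · intro i _
        rw [(hσ i).1]

variable {τ σ : Perm ι} {p q a : ι}

/-- The vertex `i` lies on no common edge of the matchings `σ` and `τ` other than `{p, q}`. -/
def Unmatched (τ : Perm ι) (p q : ι) (σ : Perm ι) (i : ι) : Prop :=
  ¬ (σ i = τ i ∧ i ≠ p ∧ i ≠ q)

instance (τ : Perm ι) (p q : ι) (σ : Perm ι) : DecidablePred (Unmatched τ p q σ) :=
  fun i => inferInstanceAs (Decidable (¬ (σ i = τ i ∧ i ≠ p ∧ i ≠ q)))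

/-- The matching obtained from `τ` by replacing the edges `{p, q}` and `{a, τ a}` with
`{a, p}` and `{τ a, q}`. -/
def rematch (τ : Perm ι) (q a : ι) : Perm ι := swap a q * τ * swap a q

lemma rematch_mem_matchings (hτ : τ ∈ matchings ι) (q a : ι) : rematch τ q a ∈ matchings ι := by
  rw [mem_matchings] at hτ ⊢
  intro i
  refine ⟨by simp [rematch, (hτ _).1], fun h => (hτ (swap a q i)).2 ?_⟩
  rw [← swap_apply_self a q (τ _)]
  exact congrArg _ h

lemma rematch_apply_left (hτ : τ ∈ matchings ι) (hpq : τ p = q) (hap : a ≠ p) :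
    rematch τ q a a = p := by
  rw [mem_matchings] at hτ
  have hqp : τ q = p := by rw [← hpq, (hτ p).1]
  have h : p ≠ q := by rw [← hpq]; exact (hτ p).2.symm
  simp [rematch, hqp, swap_apply_of_ne_of_ne hap.symm h]

lemma rematch_apply_partner (hτ : τ ∈ matchings ι) (hpq : τ p = q) (hap : a ≠ p) :
    rematch τ q a (τ a) = q := by
  rw [mem_matchings] at hτ
  have h : τ a ≠ q := by rw [← hpq]; exact fun h => hap (τ.injective h)
  simp [rematch, swap_apply_of_ne_of_ne (hτ a).2 h, (hτ a).1]

lemma rematch_apply_of_ne (hτ : τ ∈ matchings ι) (hpq : τ p = q) {i : ι}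
    (hia : i ≠ a) (hita : i ≠ τ a) (hip : i ≠ p) (hiq : i ≠ q) :
    rematch τ q a i = τ i := by
  rw [mem_matchings] at hτ
  have h1 : τ i ≠ a := fun h => hita (by rw [← h, (hτ i).1])
  have h2 : τ i ≠ q := fun h => hip (τ.injective (h.trans hpq.symm))
  simp [rematch, swap_apply_of_ne_of_ne hia hiq, swap_apply_of_ne_of_ne h1 h2]

lemma unmatched_apply_self (hσ : σ ∈ matchings ι) (hτ : τ ∈ matchings ι) (hpq : τ p = q) {i : ι}
    (hi : Unmatched τ p q σ i) : Unmatched τ p q σ (σ i) := by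
  rw [mem_matchings] at hσ hτ
  rintro ⟨h, hp, hq⟩
  rw [(hσ i).1] at h
  have h' : σ i = τ i := by rw [h, (hτ _).1, ← h]
  refine hi ⟨h', ?_, ?_⟩
  · rintro rfl
    exact hq (h'.trans hpq)
  · rintro rfl
    exact hp (by rw [h', ← hpq, (hτ p).1])

lemma unmatched_apply (hσ : σ ∈ matchings ι) (hτ : τ ∈ matchings ι) (hpq : τ p = q) {i : ι}
    (hi : Unmatched τ p q σ i) : Unmatched τ p q σ (τ i) := by
  rw [mem_matchings] at hσ hτ
  rintro ⟨h, hp, hq⟩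
  rw [(hτ i).1] at h
  refine hi ⟨by rw [← (hσ (τ i)).1, h], ?_, ?_⟩
  · rintro rfl
    exact hq hpq
  · rintro rfl
    exact hp (by rw [← hpq, (hτ p).1])

lemma card_le_of_unmatched (hσ : σ ∈ matchings ι) (hτ : τ ∈ matchings ι) (hpq : τ p = q)
    {s : Finset ι} (hs : ∀ i ∈ s, Unmatched τ p q σ i) :
    s.card ≤ 2 * ((Finset.univ.filter fun i => i < σ i).filter (Unmatched τ p q σ)).card := by
  have hσ' := mem_matchings.mp hσ
  set t := (Finset.univ.filter fun i => i < σ i).filter (Unmatched τ p q σ) with ht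
  have hsub : s ⊆ t ∪ t.image σ := by
    intro i hi
    rw [Finset.mem_union, Finset.mem_image]
    rcases lt_or_gt_of_ne (hσ' i).2 with h | h
    · refine Or.inr ⟨σ i, ?_, (hσ' i).1⟩
      simpa [ht, (hσ' i).1, h] using unmatched_apply_self hσ hτ hpq (hs i hi)
    · left
      simpa [ht, h] using hs i hi
  calc s.card ≤ (t ∪ t.image σ).card := Finset.card_le_card hsub
    _ ≤ t.card + (t.image σ).card := Finset.card_union_le _ _
    _ ≤ 2 * t.card := by have := Finset.card_image_le (s := t) (f := σ); omega

/-- A matching with at most two unmatched edges is `τ` or is obtained from it by rematching. -/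
lemma eq_or_eq_rematch (hσ : σ ∈ matchings ι) (hτ : τ ∈ matchings ι) (hpq : τ p = q)
    (hcard : ((Finset.univ.filter fun i => i < σ i).filter (Unmatched τ p q σ)).card ≤ 2) :
    σ = τ ∨ ∃ a, a ≠ p ∧ a ≠ q ∧ σ = rematch τ q a := by
  have hσ' := mem_matchings.mp hσ
  have hτ' := mem_matchings.mp hτ
  have hqp : τ q = p := by rw [← hpq, (hτ' p).1]
  have hne : p ≠ q := by rw [← hpq]; exact (hτ' p).2.symm
  have hp : Unmatched τ p q σ p := by simp [Unmatched]
  have hq : Unmatched τ p q σ q := by simp [Unmatched]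
  have key : ∀ s : Finset ι, (∀ i ∈ s, Unmatched τ p q σ i) → s.card ≤ 4 := fun s hs =>
    (card_le_of_unmatched hσ hτ hpq hs).trans (by omega)
  by_cases hσp : σ p = q
  · have hσq : σ q = p := by rw [← hσp, (hσ' p).1]
    left
    ext1 i
    by_contra hi
    have hip : i ≠ p := by rintro rfl; exact hi (hσp.trans hpq.symm)
    have hiq : i ≠ q := by rintro rfl; exact hi (hσq.trans hqp.symm)
    have hu : Unmatched τ p q σ i := fun h => hi h.1
    have := key {p, q, i, σ i, τ i} (by
      simp only [Finset.mem_insert, Finset.mem_singleton]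
      rintro j (rfl | rfl | rfl | rfl | rfl)
      exacts [hp, hq, hu, unmatched_apply_self hσ hτ hpq hu, unmatched_apply hσ hτ hpq hu])
    have h1 : p ≠ σ i := fun h => hiq (σ.injective (h.symm.trans hσq.symm))
    have h2 : q ≠ σ i := fun h => hip (σ.injective (h.symm.trans hσp.symm))
    have h3 : p ≠ τ i := fun h => hiq (τ.injective (h.symm.trans hqp.symm))
    have h4 : q ≠ τ i := fun h => hip (τ.injective (h.symm.trans hpq.symm))
    have h5 := (hσ' i).2.symm
    have h6 := (hτ' i).2.symm
    rw [Finset.card_insert_of_notMem (by simp [*, hip.symm]),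
      Finset.card_insert_of_notMem (by simp [*, hiq.symm]),
      Finset.card_insert_of_notMem (by simp [*]),
      Finset.card_insert_of_notMem (by simp [*]), Finset.card_singleton] at this
    omega
  · right
    set a := σ p with ha
    have hσa : σ a = p := (hσ' p).1
    have hap : a ≠ p := (hσ' p).2
    have hu : Unmatched τ p q σ a := unmatched_apply_self hσ hτ hpq hp
    have hut : Unmatched τ p q σ (τ a) := unmatched_apply hσ hτ hpq hu
    have hat : a ≠ τ a := (hτ' a).2.symm
    have htp : τ a ≠ p := fun h => hσp (τ.injective (h.trans hqp.symm))
    have htq : τ a ≠ q := fun h => hap (τ.injective (h.trans hpq.symm))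
    have hmem : ∀ i, i ≠ p → i ≠ q → i ≠ a → i ≠ τ a → ¬ Unmatched τ p q σ i := by
      intro i h1 h2 h3 h4 hi
      have := key {p, q, a, τ a, i} (by
        simp only [Finset.mem_insert, Finset.mem_singleton]
        rintro j (rfl | rfl | rfl | rfl | rfl)
        exacts [hp, hq, hu, hut, hi])
      rw [Finset.card_insert_of_notMem (by simp [hne, hap.symm, htp.symm, h1.symm]),
        Finset.card_insert_of_notMem (by simp [Ne.symm hσp, htq.symm, h2.symm]),
        Finset.card_insert_of_notMem (by simp [hat, h3.symm]),
        Finset.card_insert_of_notMem (by simp [h4.symm]), Finset.card_singleton] at this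
      omega
    have hσt : σ (τ a) = q := by
      by_contra h
      refine hmem (σ (τ a)) ?_ h ?_ (hσ' _).2 (unmatched_apply_self hσ hτ hpq hut)
      · exact fun h => hat.symm (σ.injective (h.trans hσa.symm))
      · exact fun h => htp (σ.injective (h.trans ha))
    refine ⟨a, hap, hσp, ?_⟩
    have hr' := mem_matchings.mp (rematch_mem_matchings hτ q a)
    have hra := rematch_apply_left hτ hpq hap
    have hrt := rematch_apply_partner hτ hpq hap
    ext1 i
    by_cases h1 : i = p
    · rw [h1, ← ha, ← hra, (hr' a).1]
    by_cases h2 : i = q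
    · have hrq : rematch τ q a q = τ a := by
        rw [← (hr' (τ a)).1, hrt]
      rw [h2, hrq, ← hσt, (hσ' _).1]
    by_cases h3 : i = a
    · rw [h3, hσa, hra]
    by_cases h4 : i = τ a
    · rw [h4, hσt, hrt]
    have := hmem i h1 h2 h3 h4
    rw [Unmatched, not_not] at this
    rw [this.1, rematch_apply_of_ne hτ hpq h3 h4 h1 h2]

lemma filter_unmatched_self (hτ : τ ∈ matchings ι) (hpq : τ p = q) (hlt : p < q) :
    (Finset.univ.filter fun i => i < τ i).filter (Unmatched τ p q τ) = {p} := by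
  have hqp : τ q = p := by rw [← hpq, ((mem_matchings.mp hτ) p).1]
  ext i
  simp only [Finset.mem_filter, Finset.mem_univ, true_and, Unmatched, Finset.mem_singleton]
  constructor
  · rintro ⟨h, hn⟩
    by_contra hip
    refine hn ⟨hip, ?_⟩
    rintro rfl
    exact absurd (h.trans_eq hqp) hlt.not_gt
  · rintro rfl
    exact ⟨hlt.trans_eq hpq.symm, fun h => h.1 rfl⟩

lemma filter_unmatched_rematch (hτ : τ ∈ matchings ι) (hpq : τ p = q)
    (hmax : ∀ i, i ≠ p → i ≠ q → i < p ∧ i < q) (hap : a ≠ p) (haq : a ≠ q) :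
    (Finset.univ.filter fun i => i < rematch τ q a i).filter
      (Unmatched τ p q (rematch τ q a)) = {a, τ a} := by
  have hτ' := mem_matchings.mp hτ
  have hr' := mem_matchings.mp (rematch_mem_matchings hτ q a)
  have hqp : τ q = p := by rw [← hpq, (hτ' p).1]
  have hne : p ≠ q := by rw [← hpq]; exact (hτ' p).2.symm
  have hra := rematch_apply_left hτ hpq hap
  have hrt := rematch_apply_partner hτ hpq hap
  have htp : τ a ≠ p := fun h => haq (τ.injective (h.trans hqp.symm))
  have htq : τ a ≠ q := fun h => hap (τ.injective (h.trans hpq.symm))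
  ext i
  simp only [Finset.mem_filter, Finset.mem_univ, true_and, Unmatched, Finset.mem_insert,
    Finset.mem_singleton]
  constructor
  · rintro ⟨h, hn⟩
    by_contra! hi
    have hip : i ≠ p := by
      rintro rfl
      rw [← hra, (hr' a).1, hra] at h
      exact h.not_gt (hmax a hap haq).1
    have hiq : i ≠ q := by
      rintro rfl
      nth_rewrite 3 [← hrt] at h
      rw [(hr' _).1] at h
      exact h.not_gt (hmax _ htp htq).2
    exact hn ⟨rematch_apply_of_ne hτ hpq hi.1 hi.2 hip hiq, hip, hiq⟩
  · rintro (rfl | rfl)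
    · rw [hra]
      exact ⟨(hmax _ hap haq).1, fun h => htp h.1.symm⟩
    · rw [hrt, (hτ' a).1]
      exact ⟨(hmax _ htp htq).2, fun h => haq h.1.symm⟩

end Matchings

section LowDegree

open MvPolynomial Equiv

variable {ι V R : Type*} [Fintype ι] [LinearOrder ι] [CommRing R] {τ : Perm ι} {p q : ι}
  {f : ι → ι → MvPolynomial V R}

/-- The summand of the Pfaffian of `J + f` indexed by the matching `σ`, where `J` is supported on
the edges of `τ` other than `{p, q}`. -/
noncomputable def matchingTerm (τ : Perm ι) (p q : ι) (f : ι → ι → MvPolynomial V R)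
    (σ : Perm ι) : MvPolynomial V R :=
  ∏ i with i < σ i, ((if Unmatched τ p q σ i then 0 else 1) + f i (σ i))

lemma homogeneousComponent_zero_sum_matchingTerm (hτ : τ ∈ matchings ι) (hpq : τ p = q)
    (hf : ∀ i j, (f i j).IsHomogeneous 1) :
    homogeneousComponent 0 (∑ σ ∈ matchings ι, matchingTerm τ p q f σ) = 0 := by
  rw [map_sum]
  refine Finset.sum_eq_zero fun σ hσ => homogeneousComponent_prod_ite_add_of_lt (fun i => hf _ _) _ ?_
  have := card_le_of_unmatched hσ hτ hpq (s := {p}) (by simp [Unmatched])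
  rw [Finset.card_singleton] at this
  omega

lemma homogeneousComponent_one_sum_matchingTerm (hτ : τ ∈ matchings ι) (hpq : τ p = q)
    (hlt : p < q) (hmax : ∀ i, i ≠ p → i ≠ q → i < p ∧ i < q)
    (hf : ∀ i j, (f i j).IsHomogeneous 1) :
    homogeneousComponent 1 (∑ σ ∈ matchings ι, matchingTerm τ p q f σ) = f p q := by
  rw [map_sum, Finset.sum_eq_single_of_mem τ hτ]
  · have h := homogeneousComponent_card_prod_ite_add (N := Unmatched τ p q τ)
      (fun i => hf i (τ i)) (Finset.univ.filter fun i => i < τ i)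
    rw [filter_unmatched_self hτ hpq hlt, Finset.card_singleton, Finset.prod_singleton, hpq] at h
    exact h
  · intro σ hσ hne
    refine homogeneousComponent_prod_ite_add_of_lt (fun i => hf _ _) _ ?_
    by_contra! hcard
    obtain h | ⟨a, hap, haq, rfl⟩ := eq_or_eq_rematch hσ hτ hpq (by omega)
    · exact hne h
    · rw [filter_unmatched_rematch hτ hpq hmax hap haq,
        Finset.card_pair ((mem_matchings.mp hτ) a).2.symm] at hcard
      omega

lemma homogeneousComponent_two_sum_matchingTerm (hτ : τ ∈ matchings ι) (hpq : τ p = q)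
    (hlt : p < q) (hmax : ∀ i, i ≠ p → i ≠ q → i < p ∧ i < q)
    (hf : ∀ i j, (f i j).IsHomogeneous 1) :
    homogeneousComponent 2 (∑ σ ∈ matchings ι, matchingTerm τ p q f σ) =
      f p q * (∑ i with i < τ i ∧ i ≠ p, f i (τ i)) +
        ∑ a with a ≠ p ∧ a ≠ q, f a p * f (τ a) q := by
  have hτ' := mem_matchings.mp hτ
  rw [map_sum, ← Finset.add_sum_erase _ _ hτ]
  congr 1
  · have h := homogeneousComponent_card_add_one_prod_ite_add (N := Unmatched τ p q τ)
      (fun i => hf i (τ i)) (Finset.univ.filter fun i => i < τ i)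
    have hfilter : (Finset.univ.filter fun i => i < τ i).filter (fun i => ¬ Unmatched τ p q τ i) =
        Finset.univ.filter fun i => i < τ i ∧ i ≠ p := by
      rw [← Finset.filter_filter]
      ext i
      have := Finset.ext_iff.mp (filter_unmatched_self hτ hpq hlt) i
      simp only [Finset.mem_filter, Finset.mem_singleton] at this ⊢
      tauto
    rw [hfilter, filter_unmatched_self hτ hpq hlt, Finset.card_singleton, Finset.prod_singleton,
      hpq] at h
    exact h
  · symm
    refine Finset.sum_of_injOn (rematch τ q) ?_ ?_ ?_ ?_
    · intro a ha b hb hab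
      simp only [Finset.coe_filter, Finset.mem_univ, true_and, Set.mem_ofPred_eq] at ha hb
      refine (rematch τ q a).injective ?_
      rw [rematch_apply_left hτ hpq ha.1]
      rw [hab, rematch_apply_left hτ hpq hb.1]
    · intro a ha
      simp only [Finset.coe_filter, Finset.mem_univ, true_and, Set.mem_ofPred_eq] at ha
      rw [Finset.mem_coe, Finset.mem_erase]
      refine ⟨fun h => ?_, rematch_mem_matchings hτ q a⟩
      have h1 := rematch_apply_left hτ hpq ha.1
      rw [h] at h1
      exact ha.2 (by rw [← hpq, ← h1, (hτ' a).1])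
    · intro σ hσ hnot
      rw [Finset.mem_erase] at hσ
      refine homogeneousComponent_prod_ite_add_of_lt (fun i => hf _ _) _ ?_
      by_contra! hcard
      obtain h | ⟨a, hap, haq, rfl⟩ := eq_or_eq_rematch hσ.2 hτ hpq hcard
      · exact hσ.1 h
      · exact hnot ⟨a, by simp [hap, haq], rfl⟩
    · intro a ha
      simp only [Finset.mem_filter, Finset.mem_univ, true_and] at ha
      have h := homogeneousComponent_card_prod_ite_add
        (N := Unmatched τ p q (rematch τ q a))
        (fun i => hf i (rematch τ q a i)) (Finset.univ.filter fun i => i < rematch τ q a i)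
      rw [filter_unmatched_rematch hτ hpq hmax ha.1 ha.2, Finset.card_pair (hτ' a).2.symm,
        Finset.prod_pair (hτ' a).2.symm, rematch_apply_left hτ hpq ha.1,
        rematch_apply_partner hτ hpq ha.1] at h
      exact h.symm

end LowDegree

section Generic

open MvPolynomial

lemma tau0_lt {m i : ℕ} (h : i < 2 * m) : tau0 i < 2 * m := by
  unfold tau0; split <;> omega

lemma tau0_tau0 (i : ℕ) : tau0 (tau0 i) = i := by
  unfold tau0; split <;> split <;> omega

lemma tau0_ne (i : ℕ) : tau0 i ≠ i := by
  unfold tau0; split <;> omega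

/-- The involution `tau0` as a permutation of `Fin (2 * m)`. -/
def tauPerm (m : ℕ) : Equiv.Perm (Fin (2 * m)) :=
  Function.Involutive.toPerm (fun i => ⟨tau0 i, tau0_lt i.2⟩)
    fun i => Fin.ext (tau0_tau0 i)

lemma tauPerm_mem_matchings (m : ℕ) : tauPerm m ∈ matchings (Fin (2 * m)) :=
  mem_matchings.mpr fun i =>
    ⟨Fin.ext (tau0_tau0 i), fun h => tau0_ne i (congrArg Fin.val h)⟩

variable {k : Type*} [Field k] {m : ℕ}

lemma AmatSym_apply_of_lt {i j : Fin (2 * m)} (h : i < j) :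
    AmatSym k m i j = X (pidx m i j h j.2) := by
  simp [AmatSym, h, pidx]

lemma AmatSym_comm (i j : Fin (2 * m)) : AmatSym k m i j = AmatSym k m j i := by
  rcases lt_trichotomy i j with h | h | h
  · simp [AmatSym, h, h.not_gt]
  · rw [h]
  · simp [AmatSym, h, h.not_gt]

lemma AmatSym_self (i : Fin (2 * m)) : AmatSym k m i i = 0 := by
  simp [AmatSym]

lemma isHomogeneous_AmatSym (i j : Fin (2 * m)) : (AmatSym k m i j).IsHomogeneous 1 := by
  simp only [AmatSym, Matrix.of_apply]
  split_ifs
  exacts [isHomogeneous_X _ _, isHomogeneous_X _ _, isHomogeneous_zero _ _ _]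

lemma Jmat_self (R : Type*) [CommRing R] (r n : ℕ) (i : Fin n) : Jmat R r n i i = 0 := by
  simp [Jmat]

lemma Jmat_comm (R : Type*) [CommRing R] [CharP R 2] (r n : ℕ) (i j : Fin n) :
    Jmat R r n i j = Jmat R r n j i := by
  simp only [Jmat, Matrix.of_apply, CharTwo.neg_eq]
  split_ifs <;> rfl

lemma Jmat_apply_of_lt (R : Type*) [CommRing R] {p q : Fin (2 * m)} (hp : p.1 = 2 * m - 2)
    (hq : q.1 = 2 * m - 1) {σ : Equiv.Perm (Fin (2 * m))} {i : Fin (2 * m)} (h : i < σ i) :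
    Jmat R (m - 1) (2 * m) i (σ i) =
      if Unmatched (tauPerm m) p q σ i then 0 else 1 := by
  have hτ : (tauPerm m i : ℕ) = tau0 i := rfl
  have h2 := (σ i).2
  rw [Fin.lt_def] at h
  simp only [Jmat, Matrix.of_apply, Unmatched, Fin.ext_iff, hτ, tau0, hp, hq, ne_eq]
  split_ifs <;> first | rfl | omega

lemma det_Jmat_add_AmatSym [CharP k 2] {p q : Fin (2 * m)} (hp : p.1 = 2 * m - 2)
    (hq : q.1 = 2 * m - 1) :
    (Jmat (MvPolynomial (PairIdx m) k) (m - 1) (2 * m) + AmatSym k m).det =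
      (∑ σ ∈ matchings (Fin (2 * m)), matchingTerm (tauPerm m) p q (AmatSym k m) σ) ^ 2 := by
  rw [det_eq_sum_matchings_sq]
  · congr 1
    refine Finset.sum_congr rfl fun σ _ => Finset.prod_congr rfl fun i hi => ?_
    rw [Matrix.add_apply, Jmat_apply_of_lt _ hp hq (Finset.mem_filter.mp hi).2]
  · intro i j
    rw [Matrix.add_apply, Matrix.add_apply, Jmat_comm, AmatSym_comm]
  · intro i
    rw [Matrix.add_apply, Jmat_self, AmatSym_self, add_zero]

end Generic

/-- Over a field `k` of characteristic `2` and for `m ≥ 2`, let `g` be the (unique)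
polynomial with `g² = det(J_{2m-2,2m} + A)` where `A` is the generic anti-symmetric
matrix, and let `z := x_{2m-1,2m}`. Then the homogeneous components of `g` are:
degree `0` is `0`, degree `1` is `z`, and degree `2` is
`∑_{j=1}^{m-1} x_{2j-1,2j}·z + ∑_{i=1}^{2m-2} x_{i,2m-1}·x_{τ(i),2m}`
(indices in the paper are 1-based; here they are realized 0-based in `Fin (2m)`). -/
theorem sqrt_det_low_terms_corank_two {k : Type*} [Field k] [CharP k 2] {m : ℕ}
    (hm : 2 ≤ m) :
    ∀ g : MvPolynomial (PairIdx m) k,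
      g ^ 2 = (Jmat (MvPolynomial (PairIdx m) k) (m-1) (2*m) + AmatSym k m).det →
        MvPolynomial.homogeneousComponent 0 g = 0 ∧
        MvPolynomial.homogeneousComponent 1 g =
          MvPolynomial.X (pidx m (2*m-2) (2*m-1) (by omega) (by omega)) ∧
        MvPolynomial.homogeneousComponent 2 g =
          (∑ j : Fin (m-1),
            MvPolynomial.X (pidx m (2*j.1) (2*j.1+1) (by omega) (by have := j.2; omega)) *
            MvPolynomial.X (pidx m (2*m-2) (2*m-1) (by omega) (by omega))) +
          ∑ i : Fin (2*m-2),
            MvPolynomial.X (pidx m i.1 (2*m-2) (by have := i.2; omega) (by omega)) *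
            MvPolynomial.X (pidx m (tau0 i.1) (2*m-1)
              (by have := i.2; unfold tau0; split <;> omega) (by omega)) := by
  intro g hg
  let p : Fin (2 * m) := ⟨2 * m - 2, by omega⟩
  let q : Fin (2 * m) := ⟨2 * m - 1, by omega⟩
  have hp : p.1 = 2 * m - 2 := rfl
  have hq : q.1 = 2 * m - 1 := rfl
  have hval : ∀ i : Fin (2 * m), (tauPerm m i : ℕ) = tau0 i := fun _ => rfl
  have hτ := tauPerm_mem_matchings m
  have hpq : tauPerm m p = q := Fin.ext (by rw [hval, hp, hq, tau0, if_pos (by omega)]; omega)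
  have hlt : p < q := Fin.lt_def.mpr (by omega)
  have hmax : ∀ i, i ≠ p → i ≠ q → i < p ∧ i < q := by
    intro i h1 h2
    rw [Ne, Fin.ext_iff] at h1 h2
    rw [Fin.lt_def, Fin.lt_def]
    omega
  have hf := isHomogeneous_AmatSym (k := k) (m := m)
  rw [det_Jmat_add_AmatSym hp hq] at hg
  obtain rfl := CharTwo.sq_injective hg
  have hz : AmatSym k m p q =
      MvPolynomial.X (pidx m (2*m-2) (2*m-1) (by omega) (by omega)) := AmatSym_apply_of_lt hlt
  refine ⟨homogeneousComponent_zero_sum_matchingTerm hτ hpq hf, ?_, ?_⟩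
  · rw [homogeneousComponent_one_sum_matchingTerm hτ hpq hlt hmax hf, hz]
  · rw [homogeneousComponent_two_sum_matchingTerm hτ hpq hlt hmax hf, hz, mul_comm, Finset.sum_mul]
    congr 1
    · symm
      refine Finset.sum_bij (fun j _ => ⟨2 * j.1, by omega⟩) ?_ ?_ ?_ ?_
      · intro j _
        have hj := j.2
        simp only [Finset.mem_filter, Finset.mem_univ, true_and, Fin.lt_def, hval, ne_eq,
          Fin.ext_iff, hp, tau0]
        split <;> omega
      · intro i _ j _ hij
        rw [Fin.mk.injEq] at hij
        exact Fin.ext (by omega)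
      · intro i hi
        simp only [Finset.mem_filter, Finset.mem_univ, true_and, Fin.lt_def, hval, ne_eq,
          Fin.ext_iff, hp, tau0] at hi
        have h2 := i.2
        split at hi
        · exact ⟨⟨i / 2, by omega⟩, Finset.mem_univ _, Fin.ext (by simp only; omega)⟩
        · omega
      · intro j _
        have hj := j.2
        have h : tauPerm m ⟨2 * j.1, by omega⟩ = ⟨2 * j.1 + 1, by omega⟩ :=
          Fin.ext (by rw [hval]; simp [tau0])
        rw [h, AmatSym_apply_of_lt (Fin.lt_def.mpr (by simp))]
    · symm
      refine Finset.sum_bij (fun i _ => ⟨i.1, by omega⟩) ?_ ?_ ?_ ?_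
      · intro i _
        have hi := i.2
        simp only [Finset.mem_filter, Finset.mem_univ, true_and, ne_eq, Fin.ext_iff, hp, hq]
        omega
      · intro i _ j _ hij
        rw [Fin.mk.injEq] at hij
        exact Fin.ext hij
      · intro i hi
        simp only [Finset.mem_filter, Finset.mem_univ, true_and, ne_eq, Fin.ext_iff, hp, hq] at hi
        exact ⟨⟨i, by omega⟩, Finset.mem_univ _, rfl⟩
      · intro i _
        have hi := i.2
        have h1 : (⟨i.1, by omega⟩ : Fin (2 * m)) < p := Fin.lt_def.mpr (by simp only [hp]; omega)
        have h2 : tauPerm m ⟨i.1, by omega⟩ < q := Fin.lt_def.mpr (by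
          rw [hval, hq, tau0]; simp only; split <;> omega)
        rw [AmatSym_apply_of_lt h1, AmatSym_apply_of_lt h2]
        rfl
end

section
/- Let k be an algebraically closed field and let m be a positive integer. Then the hypersurface defined by f_{2m} = 0 in the affine space 𝔸^{m(2m−1)} = Spec k[x_{ij} : 1 ≤ i < j ≤ 2m] is irreducible; that is, the zero locus of f_{2m} in the prime spectrum of k[x_{ij} : 1 ≤ i < j ≤ 2m] is an irreducible closed set. -/
namespace MvPolynomial

variable {ι R : Type*} [CommRing R]

/-- The substitution `x_e ↦ T ^ w e * x_e`, recording the weight of a monomial as a power of the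
new variable `T`. -/
noncomputable def weightSubst (w : ι → ℕ) :
    MvPolynomial ι R →ₐ[R] Polynomial (MvPolynomial ι R) :=
  aeval fun e => Polynomial.X ^ w e * Polynomial.C (X e)

theorem weightSubst_monomial (w : ι → ℕ) (d : ι →₀ ℕ) (c : R) :
    weightSubst w (monomial d c) =
      Polynomial.C (monomial d c) * Polynomial.X ^ Finsupp.weight w d := by
  rw [weightSubst, aeval_monomial, monomial_eq (s := d) (a := c), Finsupp.weight_apply]
  simp only [Finsupp.prod, Finsupp.sum, mul_pow, Finset.prod_mul_distrib, ← pow_mul,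
    Finset.prod_pow_eq_pow_sum, map_mul, map_prod, map_pow, smul_eq_mul, mul_comm (w _)]
  rw [IsScalarTower.algebraMap_apply R (MvPolynomial ι R) (Polynomial (MvPolynomial ι R))]
  simp only [Polynomial.algebraMap_eq, algebraMap_eq]
  ring

theorem coeff_weightSubst (w : ι → ℕ) (p : MvPolynomial ι R) (n : ℕ) (d : ι →₀ ℕ) :
    ((weightSubst w p).coeff n).coeff d = if Finsupp.weight w d = n then p.coeff d else 0 := by
  classical
  induction p using MvPolynomial.induction_on' with
  | monomial u a =>
    rw [weightSubst_monomial, Polynomial.coeff_C_mul_X_pow]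
    by_cases h : u = d
    · subst h
      split_ifs <;> simp_all
    · split_ifs <;> simp [h]
  | add p q hp hq =>
    rw [map_add, Polynomial.coeff_add, coeff_add, hp, hq, coeff_add]
    split_ifs <;> simp

theorem weightSubst_injective (w : ι → ℕ) :
    Function.Injective (weightSubst (R := R) w) := by
  rw [injective_iff_map_eq_zero]
  intro p hp
  ext d
  simpa [hp] using (coeff_weightSubst w p (Finsupp.weight w d) d).symm

theorem natDegree_weightSubst (w : ι → ℕ) (p : MvPolynomial ι R) :
    (weightSubst w p).natDegree = weightedTotalDegree w p := by
  apply le_antisymm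
  · refine Polynomial.natDegree_le_iff_coeff_eq_zero.2 fun n hn => ?_
    ext d
    rw [coeff_weightSubst, coeff_zero]
    split_ifs with h
    · by_contra hd
      exact absurd (le_weightedTotalDegree w (mem_support_iff.2 hd)) (by omega)
    · rfl
  · refine Finset.sup_le fun d hd => Polynomial.le_natDegree_of_ne_zero fun h => ?_
    have := coeff_weightSubst w p (Finsupp.weight w d) d
    rw [h, if_pos rfl, coeff_zero] at this
    exact mem_support_iff.1 hd this.symm

theorem weightedTotalDegree_mul [IsDomain R] (w : ι → ℕ) {p q : MvPolynomial ι R}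
    (hp : p ≠ 0) (hq : q ≠ 0) :
    weightedTotalDegree w (p * q) = weightedTotalDegree w p + weightedTotalDegree w q := by
  have h0 {r : MvPolynomial ι R} := map_ne_zero_iff (x := r) _ (weightSubst_injective w)
  simp only [← natDegree_weightSubst, map_mul]
  exact Polynomial.natDegree_mul (h0.2 hp) (h0.2 hq)

theorem notMem_vars_of_weightedTotalDegree_eq_zero {w : ι → ℕ} {p : MvPolynomial ι R}
    (h : weightedTotalDegree w p = 0) {e : ι} (he : w e ≠ 0) : e ∉ p.vars := by
  intro hv
  obtain ⟨d, hd, hed⟩ := (mem_vars_iff_mem_support e).1 hv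
  have h1 := le_weightedTotalDegree w hd
  have h2 := Finsupp.le_weight_of_ne_zero' w (f := d) (s := e) (Finsupp.mem_support_iff.1 hed)
  omega

/-- If `p * q` has degree at most one in a weight `w`, then one of the factors involves no
variable of nonzero weight. -/
theorem weightedTotalDegree_eq_zero_or_of_mul_le_one [IsDomain R] {w : ι → ℕ}
    {p q : MvPolynomial ι R} (hp : p ≠ 0) (hq : q ≠ 0)
    (h : weightedTotalDegree w (p * q) ≤ 1) :
    weightedTotalDegree w p = 0 ∨ weightedTotalDegree w q = 0 := by
  rw [weightedTotalDegree_mul w hp hq] at h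
  omega

end MvPolynomial

namespace Pfaffian

open MvPolynomial

/-- The permutations of `Fin (2 * m)` that index the terms of the Pfaffian. -/
def IsMatching (m : ℕ) (σ : Equiv.Perm (Fin (2*m))) : Prop :=
  (∀ k : Fin m,
    σ ⟨2*k.1, by have := k.2; omega⟩ < σ ⟨2*k.1+1, by have := k.2; omega⟩) ∧
  ∀ k l : Fin m, k < l →
    σ ⟨2*k.1, by have := k.2; omega⟩ < σ ⟨2*l.1, by have := l.2; omega⟩

variable {m : ℕ} {σ τ : Equiv.Perm (Fin (2*m))}

/-- The `k`-th pair of a matching. -/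
def matchedPair (hσ : IsMatching m σ) (k : Fin m) : PairIdx m :=
  ⟨(σ ⟨2*k.1, by have := k.2; omega⟩, σ ⟨2*k.1+1, by have := k.2; omega⟩), hσ.1 k⟩

/-- The exponent of the squarefree monomial attached to a matching. -/
noncomputable def matchingExponent (hσ : IsMatching m σ) : PairIdx m →₀ ℕ :=
  ∑ k, Finsupp.single (matchedPair hσ k) 1

theorem prod_xvar_eq_monomial (R : Type*) [CommRing R] (hσ : IsMatching m σ) :
    ∏ k : Fin m,
      xvar R m (σ ⟨2*k.1, by have := k.2; omega⟩) (σ ⟨2*k.1+1, by have := k.2; omega⟩) =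
    monomial (matchingExponent hσ) 1 := by
  rw [matchingExponent, monomial_sum_one]
  exact Finset.prod_congr rfl fun k _ => dif_pos (hσ.1 k)

theorem matchingExponent_ne_zero_iff (hσ : IsMatching m σ) (e : PairIdx m) :
    matchingExponent hσ e ≠ 0 ↔ e ∈ Set.range (matchedPair hσ) := by
  simp [matchingExponent, Finsupp.finsetSum_apply, Finsupp.single_apply]

theorem eq_of_matchingExponent_eq (hσ : IsMatching m σ) (hτ : IsMatching m τ)
    (h : matchingExponent hσ = matchingExponent hτ) : σ = τ := by
  have hr : Set.range (matchedPair hσ) = Set.range (matchedPair hτ) := by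
    ext e
    rw [← matchingExponent_ne_zero_iff, ← matchingExponent_ne_zero_iff, h]
  have hfst : (fun k => (matchedPair hσ k).1.1) = fun k => (matchedPair hτ k).1.1 := by
    refine (StrictMono.range_inj (fun k l => hσ.2 k l) (fun k l => hτ.2 k l)).1 ?_
    have := congrArg (Set.image fun e : PairIdx m => e.1.1) hr
    rwa [← Set.range_comp, ← Set.range_comp] at this
  have hmono : StrictMono fun k => (matchedPair hτ k).1.1 := fun k l => hτ.2 k l
  have hpair (k : Fin m) : matchedPair hσ k = matchedPair hτ k := by
    obtain ⟨l, hl⟩ := hr ▸ Set.mem_range_self (f := matchedPair hσ) k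
    have hlk : l = k := hmono.injective
      ((congrArg (fun e : PairIdx m => e.1.1) hl).trans (congrFun hfst k))
    rw [← hl, hlk]
  ext1 x
  obtain ⟨x, hx⟩ := x
  have hk := hpair ⟨x / 2, by omega⟩
  simp only [matchedPair, Subtype.mk.injEq, Prod.mk.injEq] at hk
  rcases Nat.mod_two_eq_zero_or_one x with h2 | h2
  · convert hk.1 using 3 <;> omega
  · convert hk.2 using 3 <;> omega

theorem coeff_pfPoly_matchingExponent (R : Type*) [CommRing R] (hσ : IsMatching m σ) :
    (pfPoly R m).coeff (matchingExponent hσ) = ((Equiv.Perm.sign σ : ℤ) : R) := by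
  classical
  rw [pfPoly, coeff_sum, Finset.sum_eq_single σ]
  · rw [prod_xvar_eq_monomial R hσ, coeff_smul, coeff_monomial, if_pos rfl, zsmul_one]
  · intro τ hτ hne
    have hτ' : IsMatching m τ := (Finset.mem_filter.1 hτ).2
    rw [prod_xvar_eq_monomial R hτ', coeff_smul, coeff_monomial, if_neg, smul_zero]
    exact fun h => hne (eq_of_matchingExponent_eq hτ' hσ h)
  · exact fun h => (h (Finset.mem_filter.2 ⟨Finset.mem_univ _, hσ⟩)).elim

theorem matchedPair_mem_vars_pfPoly (R : Type*) [CommRing R] [Nontrivial R]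
    (hσ : IsMatching m σ) (k : Fin m) : matchedPair hσ k ∈ (pfPoly R m).vars := by
  refine (mem_vars_iff_mem_support _).2 ⟨matchingExponent hσ, mem_support_iff.2 ?_, Finsupp.mem_support_iff.2
    ((matchingExponent_ne_zero_iff hσ _).2 ⟨k, rfl⟩)⟩
  rw [coeff_pfPoly_matchingExponent]
  rcases Int.units_eq_one_or (Equiv.Perm.sign σ) with h | h <;> simp [h]

/-- The indicator of the pairs containing the vertex `i`. -/
def starWeight (i : Fin (2*m)) (e : PairIdx m) : ℕ :=
  if e.1.1 = i ∨ e.1.2 = i then 1 else 0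

theorem weight_matchingExponent_le_one (hσ : IsMatching m σ) (i : Fin (2*m)) :
    Finsupp.weight (starWeight i) (matchingExponent hσ) ≤ 1 := by
  simp only [matchingExponent, map_sum, Finsupp.weight_single, one_smul, starWeight]
  rw [← Finset.card_filter, Finset.card_le_one]
  have key (k : Fin m) (hk : (matchedPair hσ k).1.1 = i ∨ (matchedPair hσ k).1.2 = i) :
      k.1 = (σ.symm i).1 / 2 := by
    rcases hk with h | h <;> (rw [← h]; simp [matchedPair]; try omega)
  intro k hk l hl
  exact Fin.ext ((key k (Finset.mem_filter.1 hk).2).trans (key l (Finset.mem_filter.1 hl).2).symm)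

theorem weightedTotalDegree_pfPoly_le_one (R : Type*) [CommRing R] (i : Fin (2*m)) :
    weightedTotalDegree (starWeight i) (pfPoly R m) ≤ 1 := by
  classical
  refine Finset.sup_le fun d hd => ?_
  obtain ⟨σ, hσ, hdσ⟩ := Finset.mem_biUnion.1 (support_sum hd)
  have hσ' : IsMatching m σ := (Finset.mem_filter.1 hσ).2
  rw [prod_xvar_eq_monomial R hσ'] at hdσ
  rw [Finset.mem_singleton.1 (support_monomial_subset (support_smul hdσ))]
  exact weight_matchingExponent_le_one hσ' i

/-- Every pair containing the vertex `0` extends to a matching. -/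
theorem exists_isMatching (hm : 0 < m) (j : Fin (2*m)) (hj : 0 < j.1) :
    ∃ (σ : Equiv.Perm (Fin (2*m))) (hσ : IsMatching m σ),
      matchedPair hσ ⟨0, hm⟩ = ⟨(⟨0, by omega⟩, j), hj⟩ := by
  let f : Fin (2*m) → Fin (2*m) := fun x =>
    if x.1 = 0 then x else if x.1 = 1 then j else
      ⟨if x.1 ≤ j.1 then x.1 - 1 else x.1, by split_ifs <;> omega⟩
  have hf (x : Fin (2*m)) : (f x).1 = if x.1 = 0 then x.1 else if x.1 = 1 then j.1 else
      if x.1 ≤ j.1 then x.1 - 1 else x.1 := by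
    simp only [f]
    split_ifs <;> rfl
  have hinj : Function.Injective f := by
    intro x y hxy
    have h := congrArg Fin.val hxy
    rw [hf, hf] at h
    ext
    split_ifs at h <;> omega
  refine ⟨Equiv.ofBijective f (Finite.injective_iff_bijective.1 hinj), ⟨fun k => ?_,
    fun k l hkl => ?_⟩, ?_⟩
  · rw [Equiv.ofBijective_apply, Equiv.ofBijective_apply, Fin.lt_def, hf, hf]
    dsimp only
    split_ifs <;> omega
  · rw [Equiv.ofBijective_apply, Equiv.ofBijective_apply, Fin.lt_def, hf, hf]
    rw [Fin.lt_def] at hkl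
    dsimp only
    split_ifs <;> omega
  · simp [matchedPair, f]

theorem irreducible_pfPoly (k : Type*) [Field k] (hm : 0 < m) : Irreducible (pfPoly k m) := by
  classical
  let o : Fin (2*m) := ⟨0, by omega⟩
  have hstar (j : Fin (2*m)) (hj : 0 < j.1) :
      (⟨(o, j), hj⟩ : PairIdx m) ∈ (pfPoly k m).vars := by
    obtain ⟨σ, hσ, h⟩ := exists_isMatching hm j hj
    rw [← h]
    exact matchedPair_mem_vars_pfPoly k hσ _
  have hv1 := hstar ⟨1, by omega⟩ one_pos
  have hf0 : pfPoly k m ≠ 0 := by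
    rintro h
    simp [h] at hv1
  -- A factor not involving the vertex `0` is a unit.
  have aux (g h : MvPolynomial (PairIdx m) k) (hgh : pfPoly k m = g * h)
      (hh : weightedTotalDegree (starWeight o) h = 0) : IsUnit h := by
    have hg0 : g ≠ 0 := by rintro rfl; simp [hgh] at hf0
    have hh0 : h ≠ 0 := by rintro rfl; simp [hgh] at hf0
    have hdeg (j : Fin (2*m)) : weightedTotalDegree (starWeight j) h = 0 := by
      by_cases hj : j = o
      · rw [hj, hh]
      have hj0 : 0 < j.1 := Nat.pos_of_ne_zero fun h => hj (Fin.ext h)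
      refine (weightedTotalDegree_eq_zero_or_of_mul_le_one hg0 hh0
        (hgh ▸ weightedTotalDegree_pfPoly_le_one k j)).resolve_left fun hg => ?_
      rcases Finset.mem_union.1 (vars_mul g h (hgh ▸ hstar j hj0)) with hv | hv
      · exact notMem_vars_of_weightedTotalDegree_eq_zero hg (by simp [starWeight]) hv
      · exact notMem_vars_of_weightedTotalDegree_eq_zero hh (by simp [starWeight]) hv
    have hvars : h.vars = ∅ := Finset.eq_empty_of_forall_notMem fun e =>
      notMem_vars_of_weightedTotalDegree_eq_zero (hdeg e.1.1) (by simp [starWeight])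
    rw [vars_eq_empty_iff_eq_C] at hvars
    rw [hvars] at hh0 ⊢
    exact (isUnit_iff_ne_zero.2 fun h0 => hh0 (by rw [h0, C_0])).map C
  refine ⟨fun hu => ?_, fun g h hgh => ?_⟩
  · rw [isUnit_iff_eq_C_of_isReduced] at hu
    obtain ⟨c, -, hc⟩ := hu
    simp [hc] at hv1
  · have hg0 : g ≠ 0 := by rintro rfl; simp [hgh] at hf0
    have hh0 : h ≠ 0 := by rintro rfl; simp [hgh] at hf0
    rcases weightedTotalDegree_eq_zero_or_of_mul_le_one hg0 hh0
      (hgh ▸ weightedTotalDegree_pfPoly_le_one k o) with h0 | h0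
    · exact Or.inl (aux h g (hgh.trans (mul_comm g h)) h0)
    · exact Or.inr (aux g h hgh h0)

end Pfaffian

/-- Over an algebraically closed field `k`, the hypersurface `f_{2m} = 0` in the
affine space `𝔸^{m(2m-1)} = Spec k[x_{ij} : 1 ≤ i < j ≤ 2m]` (the space of
anti-symmetric `2m × 2m` matrices) is irreducible. -/
theorem pfaffian_hypersurface_irreducible {k : Type*} [Field k] [IsAlgClosed k]
    (m : ℕ) (hm : 0 < m) :
    IsIrreducible
      (PrimeSpectrum.zeroLocus ({pfPoly k m} : Set (MvPolynomial (PairIdx m) k))) := by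
  have hirr := Pfaffian.irreducible_pfPoly k hm
  have hprime : (Ideal.span {pfPoly k m}).IsPrime :=
    (Ideal.span_singleton_prime hirr.ne_zero).2 hirr.prime
  rw [← PrimeSpectrum.zeroLocus_span, PrimeSpectrum.isIrreducible_zeroLocus_iff,
    hprime.radical]
  exact hprime
end
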